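/- arXiv:2206.08054 — 2 statements merged into one kernel-verified Lean document; each statement's English description precedes it below -/
import Mathlib

section
/- Let X ∈ ℝ^{n×k} have rank k, let 0 < α ≤ 1, and let D ∈ ℝ^{n×n} be the diagonal matrix with D_{ii} = α and D_{jj} = 1 for all j ≠ i. Then ℓ_i(DX) ≤ ℓ_i(X), and ℓ_j(DX) ≥ ℓ_j(X) for every j ≠ i. -/
open Matrix BigOperators Finset

/-- The four Penrose conditions: `P` is the Moore–Penrose pseudoinverse of `M`. -/
def IsMoorePenrose {a b : Type*} [Fintype a] [Fintype b]
    (M : Matrix a b ℝ) (P : Matrix b a ℝ) : Prop :=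
  M * P * M = M ∧ P * M * P = P ∧ (M * P)ᵀ = M * P ∧ (P * M)ᵀ = P * M

namespace IsMoorePenrose

variable {a b : Type*} [Fintype a] [Fintype b] {M : Matrix a b ℝ} {P : Matrix b a ℝ}

theorem apply_comm (h : IsMoorePenrose M P) (p q : a) : (M * P) p q = (M * P) q p :=
  congrFun (congrFun h.2.2.1 q) p

theorem sq_le_apply_self (h : IsMoorePenrose M P) (p : a) :
    (M * P) p p ^ 2 ≤ (M * P) p p := by
  have hidem : (M * P) * (M * P) = M * P := by
    rw [← Matrix.mul_assoc, h.1]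
  have hpp : ∑ r, (M * P) p r ^ 2 = (M * P) p p := by
    conv_rhs => rw [← hidem, Matrix.mul_apply]
    exact Finset.sum_congr rfl fun r _ => by rw [h.apply_comm r p, sq]
  conv_rhs => rw [← hpp]
  exact Finset.single_le_sum (f := fun r => (M * P) p r ^ 2) (fun r _ => sq_nonneg _)
    (Finset.mem_univ p)

end IsMoorePenrose

/-- Multiplying by the diagonal matrix rescaling one coordinate is a rank-one perturbation. -/
theorem mul_diagonal_ite_mul_apply {m : Type*} [Fintype m] [DecidableEq m]
    (A B : Matrix m m ℝ) (i p q : m) (s : ℝ) :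
    (B * Matrix.diagonal (fun t => if t = i then s else 1) * A) p q =
      (B * A) p q + (s - 1) * (B p i * A i q) := by
  have hsum : (s - 1) * (B p i * A i q) =
      ∑ r, if r = i then (s - 1) * (B p r * A r q) else 0 := by
    simp
  rw [hsum, Matrix.mul_apply, Matrix.mul_apply, ← Finset.sum_add_distrib]
  refine Finset.sum_congr rfl fun r _ => ?_
  rw [Matrix.mul_diagonal]
  split_ifs <;> ring

/-- The change of the projection onto the column space under rescaling of one coordinate. -/
theorem IsMoorePenrose.rescale_apply {m l : Type*} [Fintype m] [Fintype l] [DecidableEq m]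
    {X : Matrix m l ℝ} {P Q : Matrix l m ℝ} {i : m} {s : ℝ} (hs : s ≠ 0)
    (hQ : IsMoorePenrose X Q)
    (hP : IsMoorePenrose (Matrix.diagonal (fun t => if t = i then s else 1) * X) P) (p q : m) :
    (Matrix.diagonal (fun t => if t = i then s else 1) * X * P) p q - (X * Q) p q =
      (s⁻¹ - s) * ((Matrix.diagonal (fun t => if t = i then s else 1) * X * P) p i
        * (X * Q) i q)
      - (s⁻¹ - 1) * ((Matrix.diagonal (fun t => if t = i then s else 1) * X * P) p i
        * (if q = i then 1 else 0))
      - (1 - s) * ((if p = i then 1 else 0) * (X * Q) i q) := by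
  set D : Matrix m m ℝ := Matrix.diagonal (fun t => if t = i then s else 1) with hD
  set E : Matrix m m ℝ := Matrix.diagonal (fun t => if t = i then s⁻¹ else 1) with hE
  have hED : E * D = 1 := by
    rw [hE, hD, Matrix.diagonal_mul_diagonal, ← Matrix.diagonal_one]
    congr 1
    funext t
    split_ifs <;> simp [hs]
  have hDA : D * X * P * D * (X * Q) = D * (X * Q) := by
    calc D * X * P * D * (X * Q) = (D * X * P * (D * X)) * Q := by
          simp only [Matrix.mul_assoc]
      _ = D * (X * Q) := by rw [hP.1, Matrix.mul_assoc]
  have hEB : X * Q * E * (D * X * P) = E * (D * X * P) := by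
    have hXP : E * (D * X * P) = X * P := by
      rw [← Matrix.mul_assoc, ← Matrix.mul_assoc, hED, Matrix.one_mul]
    rw [Matrix.mul_assoc, hXP, ← Matrix.mul_assoc, hQ.1]
  have hBE : D * X * P * E * (X * Q) = D * X * P * E := by
    have h := congrArg Matrix.transpose hEB
    rw [Matrix.transpose_mul (X * Q * E), Matrix.transpose_mul (X * Q), Matrix.transpose_mul E,
      hP.2.2.1, hQ.2.2.1, hE, Matrix.diagonal_transpose, ← Matrix.mul_assoc] at h
    exact h
  have h₁ := congrFun (congrFun hDA p) q
  have h₂ := congrFun (congrFun hBE p) q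
  rw [hD, mul_diagonal_ite_mul_apply, ← hD, Matrix.diagonal_mul] at h₁
  rw [hE, mul_diagonal_ite_mul_apply, Matrix.mul_diagonal] at h₂
  by_cases hp : p = i <;> by_cases hq : q = i <;>
    simp only [hp, hq, if_true, if_false] at h₁ h₂ ⊢ <;>
    linear_combination h₁ - h₂

/-- scaling the `i`-th row by `0 < α ≤ 1` does not increase the `i`-th statistical
leverage and does not decrease any other statistical leverage. The statistical leverage
`ℓ_j(M)` is the `j`-th diagonal entry of `M * M⁺`, formalized here via Moore–Penrose
pseudoinverse witnesses. -/
theorem stmt4 {n k : ℕ}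
    (X : Matrix (Fin n) (Fin k) ℝ) (hXrank : X.rank = k)
    (i : Fin n) (α : ℝ) (hα0 : 0 < α) (hα1 : α ≤ 1)
    (D : Matrix (Fin n) (Fin n) ℝ)
    (hD : D = Matrix.diagonal (fun t => if t = i then α else 1))
    (Q : Matrix (Fin k) (Fin n) ℝ) (hQ : IsMoorePenrose X Q)
    (P : Matrix (Fin k) (Fin n) ℝ) (hP : IsMoorePenrose (D * X) P) :
    ((D * X) * P) i i ≤ (X * Q) i i ∧
      ∀ j : Fin n, j ≠ i → ((D * X) * P) j j ≥ (X * Q) j j := by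
  subst hD
  have key := hQ.rescale_apply hα0.ne' hP
  have hA := hQ.sq_le_apply_self i
  have hB := hP.sq_le_apply_self i
  have hsymm := fun j => hQ.apply_comm i j
  set A := X * Q
  set B := Matrix.diagonal (fun t => if t = i then α else 1) * X * P
  have hinv : 1 ≤ α⁻¹ := (one_le_inv₀ hα0).2 hα1
  have hA0 : 0 ≤ A i i := (sq_nonneg _).trans hA
  have hB0 : 0 ≤ B i i := (sq_nonneg _).trans hB
  have hA1 : A i i ≤ 1 := by nlinarith
  have hB1 : B i i ≤ 1 := by nlinarith
  constructor
  · have h := key i i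
    simp only [if_true] at h
    have h₁ := mul_nonneg (sub_nonneg.2 hinv) (mul_nonneg hB0 (sub_nonneg.2 hA1))
    have h₂ := mul_nonneg (sub_nonneg.2 hα1) (mul_nonneg hA0 (sub_nonneg.2 hB1))
    linarith
  · intro j hj
    have hjj := key j j
    have hji := key j i
    simp only [hj, if_true, if_false] at hjj hji
    rw [hsymm j] at hjj
    have hAj : A j i = B j i * (α⁻¹ - (α⁻¹ - α) * A i i) := by linear_combination -hji
    have hc : 0 ≤ α⁻¹ - (α⁻¹ - α) * A i i := by nlinarith
    have hprod : 0 ≤ (α⁻¹ - α) * (B j i * A j i) := by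
      rw [hAj, ← mul_assoc (B j i)]
      exact mul_nonneg (by linarith) (mul_nonneg (mul_self_nonneg _) hc)
    linarith
end

section
/- Let A ∈ ℝ^{m×n} have singular value decomposition A = UΣVᵀ, let S ∈ ℝ^{n×r} be a column sampling matrix, set C = AS, and let R be an index set such that σ_i(A) > 0 for every i ∈ R. Let σ_ω = max_{i∉R} σ_i(A) and σ_μ = min_{i∈R} σ_i(A). If ‖V_RᵀS‖_F² ≥ |R| − ε for some ε ≥ 0, then ‖CC⁺U_R‖_F² ≥ ‖V_RᵀS‖_F² − 2ε·σ_ω²/σ_μ². -/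
open Matrix BigOperators Finset

section Projections

variable {E F : Type*} [NormedAddCommGroup E] [InnerProductSpace ℝ E]
  [NormedAddCommGroup F] [InnerProductSpace ℝ F]

open Submodule

lemma inner_starProjection_self (N : Submodule ℝ E) [N.HasOrthogonalProjection] (e : E) :
    inner ℝ e (N.starProjection e) = ‖N.starProjection e‖ ^ 2 := by
  have h := N.starProjection_inner_eq_zero e _ (N.starProjection_apply_mem e)
  rw [inner_sub_left, real_inner_self_eq_norm_sq] at h
  linarith

lemma inner_starProjection_of_mem (N : Submodule ℝ E) [N.HasOrthogonalProjection] (e : E)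
    {x : E} (hx : x ∈ N) : inner ℝ (N.starProjection e) x = inner ℝ e x := by
  have h := N.starProjection_inner_eq_zero e x hx
  rw [inner_sub_left] at h
  linarith

/-- The squared length of the projection of `e` onto `N` is the supremum of `⟪e, x⟫² / ‖x‖²` over
`x ∈ N`, so it can be compared with that of `e'` onto `N'` vector by vector. -/
lemma norm_sq_starProjection_le (N : Submodule ℝ E) [N.HasOrthogonalProjection]
    (N' : Submodule ℝ F) [N'.HasOrthogonalProjection] (e : E) (e' : F) {K : ℝ} (hK : 0 ≤ K)
    (h : ∀ x ∈ N, ∃ y ∈ N', inner ℝ e' y = inner ℝ e x ∧ ‖y‖ ^ 2 ≤ K * ‖x‖ ^ 2) :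
    ‖N.starProjection e‖ ^ 2 ≤ K * ‖N'.starProjection e'‖ ^ 2 := by
  obtain ⟨y, hy, hinner, hnorm⟩ := h _ (N.starProjection_apply_mem e)
  rw [inner_starProjection_self, ← inner_starProjection_of_mem N' e' hy] at hinner
  have hcs := real_inner_le_norm (N'.starProjection e') y
  rw [hinner] at hcs
  set a := ‖N.starProjection e‖
  rcases (sq_nonneg a).eq_or_lt with h0 | hpos
  · rw [← h0]; positivity
  · have h1 : (a ^ 2) ^ 2 ≤ ‖N'.starProjection e'‖ ^ 2 * (K * a ^ 2) :=
      calc (a ^ 2) ^ 2 ≤ (‖N'.starProjection e'‖ * ‖y‖) ^ 2 := by gcongr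
        _ = ‖N'.starProjection e'‖ ^ 2 * ‖y‖ ^ 2 := by ring
        _ ≤ _ := by gcongr
    exact le_of_mul_le_mul_right (by linarith) hpos

lemma sum_norm_sq_starProjection {ι : Type*} [Fintype ι] [FiniteDimensional ℝ E]
    (b : OrthonormalBasis ι ℝ E) (N : Submodule ℝ E) :
    ∑ i, ‖N.starProjection (b i)‖ ^ 2 = Module.finrank ℝ N := by
  let w := stdOrthonormalBasis ℝ N
  have h (i : ι) : ‖N.starProjection (b i)‖ ^ 2 = ∑ k, ‖inner ℝ (b i) (w k : E)‖ ^ 2 := by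
    rw [starProjection_apply, ← Submodule.coe_norm, ← w.sum_sq_norm_inner_left]
    simp only [inner_orthogonalProjectionOnto_eq_of_mem_right]
  simp_rw [h]
  rw [Finset.sum_comm]
  have h' (k) : ∑ i, ‖inner ℝ (b i) (w k : E)‖ ^ 2 = 1 := by
    rw [b.sum_sq_norm_inner_right, ← Submodule.coe_norm, w.norm_eq_one, one_pow]
  simp only [h', Finset.sum_const, Finset.card_univ, Fintype.card_fin, nsmul_eq_mul, mul_one]

/-- A norm-increasing map that fixes the coordinates outside `s` can only increase the part of a
subspace that lies along `s`. -/
lemma sum_norm_sq_starProjection_le_map {ι : Type*} [Fintype ι] [DecidableEq ι]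
    [FiniteDimensional ℝ E] (b : OrthonormalBasis ι ℝ E) (N : Submodule ℝ E) (D : E →ₗ[ℝ] E)
    (s : Finset ι) (hD : ∀ x, ‖x‖ ≤ ‖D x‖)
    (hs : ∀ x, ∀ j ∉ s, inner ℝ (b j) (D x) = inner ℝ (b j) x) :
    ∑ i ∈ s, ‖N.starProjection (b i)‖ ^ 2 ≤ ∑ i ∈ s, ‖(N.map D).starProjection (b i)‖ ^ 2 := by
  have hinj : Function.Injective D := by
    rw [injective_iff_map_eq_zero]
    intro x hx
    simpa [hx] using hD x
  have hdim : Module.finrank ℝ (N.map D) = Module.finrank ℝ N :=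
    (Submodule.equivMapOfInjective D hinj N).symm.finrank_eq
  have hcompl : ∑ i ∈ sᶜ, ‖(N.map D).starProjection (b i)‖ ^ 2
      ≤ ∑ i ∈ sᶜ, ‖N.starProjection (b i)‖ ^ 2 := by
    refine Finset.sum_le_sum fun j hj => ?_
    rw [← one_mul (‖N.starProjection (b j)‖ ^ 2)]
    refine norm_sq_starProjection_le _ _ _ _ zero_le_one ?_
    rintro _ ⟨x, hx, rfl⟩
    refine ⟨x, hx, (hs x j (Finset.mem_compl.mp hj)).symm, ?_⟩
    rw [one_mul]
    gcongr
    exact hD x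
  have h1 := sum_norm_sq_starProjection b N
  have h2 := sum_norm_sq_starProjection b (N.map D)
  rw [← Finset.sum_add_sum_compl s] at h1 h2
  rw [hdim] at h2
  linarith

end Projections

lemma sum_filter_val_mem {k : ℕ} (R : Finset ℕ) (hR : ∀ i ∈ R, i < k) (g : Fin k → ℝ) :
    ∑ i ∈ Finset.univ.filter (fun i : Fin k => (i : ℕ) ∈ R), g i
      = ∑ i : R, g ⟨i, hR i i.2⟩ := by
  refine Finset.sum_bij' (fun i hi => ⟨i, (Finset.mem_filter.mp hi).2⟩)
    (fun i _ => ⟨i, hR i i.2⟩) ?_ ?_ ?_ ?_ ?_ <;> simp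

lemma sum_ite_val_eq {m : ℕ} (a : Fin m → ℝ) (j : ℕ) :
    (∑ i : Fin m, if (i : ℕ) = j then a i else 0) = if h : j < m then a ⟨j, h⟩ else 0 := by
  split_ifs with h
  · rw [Finset.sum_eq_single ⟨j, h⟩] <;> simp +contextual [Fin.ext_iff]
  · exact Finset.sum_eq_zero fun i _ => if_neg fun hi => h (by omega)

lemma sum_dite_val_lt_le {m n : ℕ} (g : Fin m → ℝ) (hg : ∀ i, 0 ≤ g i) :
    (∑ j : Fin n, if h : (j : ℕ) < m ∧ (j : ℕ) < n then g ⟨j, h.1⟩ else 0) ≤ ∑ i, g i := by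
  calc _ = ∑ j : Fin n, ∑ i : Fin m, if (i : ℕ) = j then g i else 0 := by
        refine Finset.sum_congr rfl fun j _ => ?_
        rw [sum_ite_val_eq]
        simp
    _ = ∑ i : Fin m, ∑ j : Fin n, if (j : ℕ) = i then g i else 0 := by
        rw [Finset.sum_comm]
        simp only [eq_comm]
    _ ≤ ∑ i, g i := by
        refine Finset.sum_le_sum fun i _ => ?_
        rw [sum_ite_val_eq (fun _ => g i)]
        split_ifs
        · exact le_rfl
        · exact hg i

section Rectangular

variable {m n : ℕ}

/-- The rectangular diagonal matrix with diagonal entries `σ`. -/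
def rectDiagonal (m n : ℕ) (σ : ℕ → ℝ) : Matrix (Fin m) (Fin n) ℝ :=
  Matrix.of fun i j => if (i : ℕ) = (j : ℕ) then σ i else 0

lemma rectDiagonal_transpose_mulVec (σ : ℕ → ℝ) (x : Fin m → ℝ) (j : Fin n) :
    ((rectDiagonal m n σ)ᵀ *ᵥ x) j = if h : (j : ℕ) < m then σ j * x ⟨j, h⟩ else 0 := by
  rw [← sum_ite_val_eq (fun i => σ j * x i), mulVec, dotProduct]
  refine Finset.sum_congr rfl fun i _ => ?_
  by_cases h : (i : ℕ) = j <;> simp [rectDiagonal, h]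

/-- If `Σᵀ` maps `N` into `N'`, with entries at least `μ` on `R` and at most `ω` off `R`, then the
part of `N` along `R` is controlled by the part of `N'` along `R`. -/
lemma sum_norm_sq_starProjection_le_of_rectDiagonal (σ : ℕ → ℝ) (R : Finset ℕ)
    (hR : ∀ i ∈ R, i < min m n) {μ ω : ℝ} (hμ : 0 < μ) (hσ : ∀ i, 0 ≤ σ i)
    (hσμ : ∀ i ∈ R, μ ≤ σ i) (hσω : ∀ i, i < min m n → i ∉ R → σ i ≤ ω)
    (N : Submodule ℝ (EuclideanSpace ℝ (Fin m))) (N' : Submodule ℝ (EuclideanSpace ℝ (Fin n)))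
    (hN : ∀ x ∈ N, toEuclideanLin (rectDiagonal m n σ)ᵀ x ∈ N') :
    ∑ i ∈ Finset.univ.filter (fun i : Fin m => (i : ℕ) ∈ R),
        ‖N.starProjection (EuclideanSpace.basisFun (Fin m) ℝ i)‖ ^ 2
      ≤ (1 + ω ^ 2 / μ ^ 2) * ∑ i ∈ Finset.univ.filter (fun i : Fin n => (i : ℕ) ∈ R),
        ‖N'.starProjection (EuclideanSpace.basisFun (Fin n) ℝ i)‖ ^ 2 := by
  set d : Fin m → ℝ := fun i => if (i : ℕ) ∈ R then σ i / μ else 1 with hd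
  set D := toEuclideanLin (Matrix.diagonal d) with hDdef
  have hDx (x : EuclideanSpace ℝ (Fin m)) (i : Fin m) : D x i = d i * x i := by
    simp [hDdef, toLpLin_apply, mulVec_diagonal]
  have hd1 (i) : 1 ≤ d i := by
    simp only [hd]
    split_ifs with h
    · rw [le_div_iff₀ hμ, one_mul]; exact hσμ _ h
    · exact le_rfl
  refine (sum_norm_sq_starProjection_le_map (EuclideanSpace.basisFun (Fin m) ℝ) N D _ ?_ ?_).trans
    ?_
  · intro x
    rw [← sq_le_sq₀ (norm_nonneg _) (norm_nonneg _), EuclideanSpace.real_norm_sq_eq,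
      EuclideanSpace.real_norm_sq_eq]
    refine Finset.sum_le_sum fun i _ => ?_
    rw [hDx, mul_pow]
    exact le_mul_of_one_le_left (sq_nonneg _) (one_le_pow₀ (hd1 i))
  · intro x j hj
    have hj' : (j : ℕ) ∉ R := by simpa using hj
    simp [EuclideanSpace.inner_single_left, hDx, hd, hj']
  · rw [sum_filter_val_mem R fun i hi => (lt_min_iff.mp (hR i hi)).1,
      sum_filter_val_mem R fun i hi => (lt_min_iff.mp (hR i hi)).2, Finset.mul_sum]
    refine Finset.sum_le_sum fun i _ => ?_
    refine norm_sq_starProjection_le _ _ _ _ (by positivity) ?_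
    rintro _ ⟨x, hx, rfl⟩
    refine ⟨μ⁻¹ • toEuclideanLin (rectDiagonal m n σ)ᵀ x, N'.smul_mem _ (hN x hx), ?_, ?_⟩
    · have him := (lt_min_iff.mp (hR i i.2)).1
      simp [EuclideanSpace.inner_single_left, hDx, hd, toLpLin_apply,
        rectDiagonal_transpose_mulVec, him]
      ring
    · rw [EuclideanSpace.real_norm_sq_eq, EuclideanSpace.real_norm_sq_eq, Finset.mul_sum]
      refine le_trans (Finset.sum_le_sum fun j _ => ?_)
        (sum_dite_val_lt_le (n := n) (fun i => (1 + ω ^ 2 / μ ^ 2) * (D x i) ^ 2)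
          fun i => by positivity)
      by_cases h : (j : ℕ) < m
      · simp only [PiLp.smul_apply, smul_eq_mul, toLpLin_apply, rectDiagonal_transpose_mulVec, h,
          j.2, and_self, dite_true, hDx]
        by_cases hj : (j : ℕ) ∈ R
        · simp only [hd, hj, if_true]
          have : 0 ≤ ω ^ 2 / μ ^ 2 * (σ j / μ * x ⟨j, h⟩) ^ 2 := by positivity
          linear_combination this
        · simp only [hd, hj, if_false, one_mul]
          have h1 : σ j ^ 2 ≤ ω ^ 2 := pow_le_pow_left₀ (hσ j) (hσω j (lt_min h j.2) hj) 2
          have h2 : σ j ^ 2 / μ ^ 2 * x ⟨j, h⟩ ^ 2 ≤ ω ^ 2 / μ ^ 2 * x ⟨j, h⟩ ^ 2 := by gcongr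
          linear_combination h2 + sq_nonneg (x ⟨j, h⟩)
      · simp [toLpLin_apply, rectDiagonal_transpose_mulVec, h]

end Rectangular

/-- If `W` has orthonormal columns, the rows of `W` have squared length at most the squared distance
of the coordinate vectors from the kernel of `Wᵀ`. -/
lemma norm_sq_starProjection_ker_transpose_add_le {n r : ℕ} (W : Matrix (Fin n) (Fin r) ℝ)
    (hW : Wᵀ * W = 1) (i : Fin n) :
    ‖(LinearMap.ker (toEuclideanLin Wᵀ)).starProjection
      (EuclideanSpace.basisFun (Fin n) ℝ i)‖ ^ 2 + ∑ j, W i j ^ 2 ≤ 1 := by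
  set N := LinearMap.ker (toEuclideanLin Wᵀ)
  set e := EuclideanSpace.basisFun (Fin n) ℝ i with he
  set x := N.starProjection e
  set z : EuclideanSpace ℝ (Fin n) := WithLp.toLp 2 (W *ᵥ W i) with hz
  have hxN : Wᵀ *ᵥ x.ofLp = 0 := by
    have := N.starProjection_apply_mem e
    rw [LinearMap.mem_ker, toLpLin_apply] at this
    simpa using this
  have hxx : inner ℝ e x = ‖x‖ ^ 2 := inner_starProjection_self N e
  have hee : ‖e‖ ^ 2 = 1 := by simp [he]
  have hez : inner ℝ e z = ∑ j, W i j ^ 2 := by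
    simp [he, hz, EuclideanSpace.inner_single_left, mulVec, dotProduct, sq]
  have hzz : ‖z‖ ^ 2 = ∑ j, W i j ^ 2 := by
    rw [← real_inner_self_eq_norm_sq, EuclideanSpace.inner_eq_star_dotProduct]
    simp only [hz, star_trivial]
    rw [dotProduct_mulVec, ← mulVec_transpose, mulVec_mulVec, hW, one_mulVec]
    simp [dotProduct, sq]
  have hxz : inner ℝ x z = 0 := by
    rw [EuclideanSpace.inner_eq_star_dotProduct]
    simp only [hz, star_trivial]
    rw [dotProduct_comm, dotProduct_mulVec, ← mulVec_transpose, hxN, zero_dotProduct]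
  have h := sq_nonneg ‖e - x - z‖
  rw [norm_sub_sq_real, norm_sub_sq_real, inner_sub_left] at h
  linarith

/-- If `H` is an orthogonal projection and `N` contains the image under `Uᵀ` of the component of the
`i`-th column of `U` orthogonal to the range of `H`, then that component is at most as long as the
projection of the `i`-th coordinate vector onto `N`. -/
lemma one_le_sum_sq_add_norm_sq_starProjection {m : ℕ} (U H : Matrix (Fin m) (Fin m) ℝ)
    (hU : Uᵀ * U = 1) (hH : Hᵀ = H) (hH2 : H * H = H) (i : Fin m)
    (N : Submodule ℝ (EuclideanSpace ℝ (Fin m)))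
    (hN : WithLp.toLp 2 ((Uᵀ * (1 - H) * U).col i) ∈ N) :
    1 ≤ (∑ l, (H * U) l i ^ 2)
      + ‖N.starProjection (EuclideanSpace.basisFun (Fin m) ℝ i)‖ ^ 2 := by
  set e := EuclideanSpace.basisFun (Fin m) ℝ i with he
  set G := Uᵀ * (1 - H) * U with hG
  set q : EuclideanSpace ℝ (Fin m) := WithLp.toLp 2 (G.col i) with hq
  have hU' : U * Uᵀ = 1 := mul_eq_one_comm.mp hU
  have hGT : Gᵀ = G := by simp [hG, hH, Matrix.mul_assoc]
  have hGG : G * G = G := by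
    calc G * G = Uᵀ * ((1 - H) * (U * Uᵀ) * (1 - H)) * U := by simp only [hG, Matrix.mul_assoc]
      _ = G := by
        rw [hU', Matrix.mul_one]
        simp [hG, sub_mul, mul_sub, hH2]
  have hGii : G i i = 1 - ∑ l, (H * U) l i ^ 2 := by
    have : G = 1 - (H * U)ᵀ * (H * U) := by
      rw [transpose_mul, hH, Matrix.mul_assoc, ← Matrix.mul_assoc H H, hH2, hG]
      simp [Matrix.mul_sub, Matrix.sub_mul, hU, Matrix.mul_assoc]
    rw [this, Matrix.sub_apply, one_apply_eq, Matrix.mul_apply]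
    simp only [transpose_apply, sq]
  have heq : inner ℝ e q = G i i := by
    simp [he, hq, EuclideanSpace.inner_single_left]
  have hqq : ‖q‖ ^ 2 = G i i := by
    rw [EuclideanSpace.real_norm_sq_eq]
    conv_rhs => rw [← hGG, Matrix.mul_apply]
    refine Finset.sum_congr rfl fun l _ => ?_
    rw [← transpose_apply G l i, hGT]
    simp [hq, sq]
  have h := sq_nonneg ‖N.starProjection e - q‖
  rw [norm_sub_sq_real, inner_starProjection_of_mem N e hN, heq, hqq, hGii] at h
  linarith

/-- with an SVD `A = U Σ Vᵀ`, a column sampling matrix `S`, `C = A S`, an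
index set `R` with `σ_i(A) > 0` on `R`, `σ_ω = max_{i∉R} σ_i(A)`,
`σ_μ = min_{i∈R} σ_i(A)`: if `‖V_Rᵀ S‖_F² ≥ |R| − ε` for some `ε ≥ 0`, then
`‖C C⁺ U_R‖_F² ≥ ‖V_Rᵀ S‖_F² − 2 ε σ_ω²/σ_μ²`. -/
theorem stmt12 {m n r : ℕ}
    (A : Matrix (Fin m) (Fin n) ℝ)
    (U : Matrix (Fin m) (Fin m) ℝ) (V : Matrix (Fin n) (Fin n) ℝ)
    (σ : ℕ → ℝ)
    (hU : Uᵀ * U = 1) (hV : Vᵀ * V = 1)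
    (hσ_nonneg : ∀ i, 0 ≤ σ i)
    (hσ_mono : ∀ i j : ℕ, i ≤ j → σ j ≤ σ i)
    (hA : A = U * (Matrix.of fun (i : Fin m) (j : Fin n) =>
        if (i : ℕ) = (j : ℕ) then σ i else 0) * Vᵀ)
    (f : Fin r → Fin n) (hf : Function.Injective f)
    (S : Matrix (Fin n) (Fin r) ℝ)
    (hS : S = Matrix.of fun i j => if i = f j then (1 : ℝ) else 0)
    (C : Matrix (Fin m) (Fin r) ℝ) (hC : C = A * S)
    (Cp : Matrix (Fin r) (Fin m) ℝ) (hCp : IsMoorePenrose C Cp)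
    (R : Finset ℕ) (hR : ∀ i ∈ R, i < min m n)
    (hRpos : ∀ i ∈ R, 0 < σ i)
    (σω σμ : ℝ)
    (hσω : σω = sSup (σ '' {i : ℕ | i < min m n ∧ i ∉ R}))
    (hσμ : σμ = sInf (σ '' {i : ℕ | i ∈ R}))
    (ε : ℝ) (hε : 0 ≤ ε)
    (hVS : ∑ i ∈ Finset.univ.filter (fun i : Fin n => (i : ℕ) ∈ R),
        ∑ j, ((Vᵀ * S) i j) ^ 2 ≥ (R.card : ℝ) - ε) :
    ∑ i ∈ Finset.univ.filter (fun i : Fin m => (i : ℕ) ∈ R),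
        ∑ l, ((C * Cp * U) l i) ^ 2
      ≥ (∑ i ∈ Finset.univ.filter (fun i : Fin n => (i : ℕ) ∈ R),
            ∑ j, ((Vᵀ * S) i j) ^ 2)
        - 2 * ε * σω ^ 2 / σμ ^ 2 := by
  rcases R.eq_empty_or_nonempty with rfl | hRne
  · simp [hσμ]
  have hRm (i) (hi : i ∈ R) : i < m := (lt_min_iff.mp (hR i hi)).1
  have hRn (i) (hi : i ∈ R) : i < n := (lt_min_iff.mp (hR i hi)).2
  have hμ_eq : σμ = sInf (σ '' (R : Set ℕ)) := hσμ
  have hμ_le (i) (hi : i ∈ R) : σμ ≤ σ i := by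
    rw [hμ_eq]
    exact csInf_le (R.finite_toSet.image σ).bddBelow ⟨i, hi, rfl⟩
  have hμ_pos : 0 < σμ := by
    have hmem : σμ ∈ σ '' (R : Set ℕ) := by
      rw [hμ_eq]
      exact (hRne.to_set.image σ).csInf_mem (R.finite_toSet.image σ)
    obtain ⟨i, hi, h⟩ := hmem
    exact h ▸ hRpos i hi
  have hω (i) (hi : i < min m n) (hiR : i ∉ R) : σ i ≤ σω := by
    rw [hσω]
    refine le_csSup ⟨σ 0, ?_⟩ ⟨i, ⟨hi, hiR⟩, rfl⟩
    rintro _ ⟨k, -, rfl⟩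
    exact hσ_mono 0 k k.zero_le
  have hV' : V * Vᵀ = 1 := mul_eq_one_comm.mp hV
  have hSS : Sᵀ * S = 1 := by
    ext i j
    simp [hS, Matrix.mul_apply, Matrix.one_apply, hf.eq_iff, eq_comm]
  set W := Vᵀ * S with hWdef
  have hW : Wᵀ * W = 1 := by
    rw [hWdef, transpose_mul, transpose_transpose, Matrix.mul_assoc, ← Matrix.mul_assoc V, hV',
      Matrix.one_mul, hSS]
  have hCW : C = U * rectDiagonal m n σ * W := by
    rw [hC, hA, hWdef, Matrix.mul_assoc _ Vᵀ]
    rfl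
  obtain ⟨hCPC, -, hCPT, -⟩ := hCp
  set H := C * Cp with hHdef
  have hH2 : H * H = H := by rw [hHdef, ← Matrix.mul_assoc, hCPC]
  have hCH : Cᵀ * (1 - H) = 0 := by
    rw [Matrix.mul_sub, Matrix.mul_one, ← hCPT, ← transpose_mul, hCPC, sub_self]
  set N' := LinearMap.ker (toEuclideanLin Wᵀ) with hN'
  set N := N'.comap (toEuclideanLin (rectDiagonal m n σ)ᵀ) with hN
  have hmem (i : Fin m) : WithLp.toLp 2 ((Uᵀ * (1 - H) * U).col i) ∈ N := by
    have h0 : Wᵀ * ((rectDiagonal m n σ)ᵀ * (Uᵀ * (1 - H) * U)) = 0 := by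
      calc _ = Cᵀ * (1 - H) * U := by simp only [hCW, transpose_mul, Matrix.mul_assoc]
        _ = 0 := by rw [hCH, Matrix.zero_mul]
    rw [hN, Submodule.mem_comap, hN', LinearMap.mem_ker]
    simp only [toLpLin_apply, ← mulVec_single_one, mulVec_mulVec, h0, zero_mulVec, WithLp.toLp_zero]
  have hmain := sum_norm_sq_starProjection_le_of_rectDiagonal σ R hR hμ_pos hσ_nonneg hμ_le hω N N'
    fun x hx => hx
  rw [sum_filter_val_mem R hRm, sum_filter_val_mem R hRn] at hmain
  rw [sum_filter_val_mem R hRn] at hVS ⊢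
  rw [sum_filter_val_mem R hRm]
  have hleft := Finset.sum_le_sum fun (i : R) (_ : i ∈ Finset.univ) =>
    one_le_sum_sq_add_norm_sq_starProjection U H hU hCPT hH2 ⟨i, hRm i i.2⟩ N (hmem _)
  have hright := Finset.sum_le_sum fun (i : R) (_ : i ∈ Finset.univ) =>
    norm_sq_starProjection_ker_transpose_add_le W hW ⟨i, hRn i i.2⟩
  rw [Finset.sum_add_distrib] at hleft hright
  simp only [Finset.sum_const, Finset.card_univ, Fintype.card_coe, nsmul_eq_mul, mul_one]
    at hleft hright
  have hρ : 0 ≤ σω ^ 2 / σμ ^ 2 := by positivity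
  rw [mul_div_assoc]
  set ρ := σω ^ 2 / σμ ^ 2
  set w := ∑ i : R, ∑ j, W ⟨i, hRn i i.2⟩ j ^ 2
  have h1 := mul_le_mul_of_nonneg_left (le_sub_iff_add_le.mpr hright) (add_nonneg zero_le_one hρ)
  have h2 : ρ * (R.card - w) ≤ ρ * ε := mul_le_mul_of_nonneg_left (by linarith) hρ
  have h3 : 0 ≤ ρ * ε := mul_nonneg hρ hε
  linarith
end
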